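/- arXiv:1805.00396 — 3 statements merged into one kernel-verified Lean document; each statement's English description precedes it below -/
import Mathlib

section
/- Let F be a finite field with |F| ≥ 2εB^{2ε}, let A be a θ×B matrix over F with θ ≤ B, let 0 ≤ ε ≤ B, and let γ be a natural number with γ ≥ min(2ε, rank(A)). Then there exist a γ×θ matrix S over F and a decoder function D : F^γ × F^θ → F^θ such that for all column vectors x, e ∈ F^B with Hamming weight of e at most ε, D((S·A)·(x + e), A·x) = A·(x + e). -/
open scoped Pointwise in
/-- Finitely many nonzero vectors, fewer than the size of the field, have a common linear functional
vanishing on none of them. -/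
theorem Module.Dual.exists_forall_ne_zero_of_card_lt {F V : Type*} [Field F] [Fintype F]
    [AddCommGroup V] [Module F V] (s : Finset V) (hs : s.card < Fintype.card F) (h0 : 0 ∉ s) :
    ∃ f : Module.Dual F V, ∀ v ∈ s, f v ≠ 0 := by
  by_contra! h
  have hcover : ⋃ v ∈ s, (0 : Module.Dual F V) +ᵥ
      ((LinearMap.ker (Module.Dual.eval F V v)).toAddSubgroup : Set (Module.Dual F V)) =
        Set.univ := by
    refine Set.eq_univ_of_forall fun f => ?_
    obtain ⟨v, hv, hfv⟩ := h f
    exact Set.mem_biUnion hv (by simpa using hfv)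
  obtain ⟨v, hv, hfin, hle⟩ := AddSubgroup.exists_index_le_card_of_leftCoset_cover hcover
  refine hle.not_gt (hs.trans_le ?_)
  obtain ⟨f, hf⟩ := Module.Projective.exists_dual_ne_zero F (ne_of_mem_of_not_mem hv h0)
  have := AddSubgroup.finite_quotient_of_finiteIndex
    (H := (LinearMap.ker (Module.Dual.eval F V v)).toAddSubgroup)
  rw [← Nat.card_eq_fintype_card]
  refine Nat.card_le_card_of_injective (fun c : F => (QuotientAddGroup.mk (c • f) :
    _ ⧸ (LinearMap.ker (Module.Dual.eval F V v)).toAddSubgroup)) fun c d hcd => ?_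
  have hmem := QuotientAddGroup.eq.mp hcd
  have hval : -(c * f v) + d * f v = 0 := by simpa using hmem
  exact mul_right_cancel₀ hf (by linear_combination -hval)

/-- A family of fewer than `|F|` subspaces of dimension at most `k` admits a linear map to `F ^ k`
that is injective on each of them. -/
theorem LinearMap.exists_disjoint_ker_of_card_lt {F V ι : Type*} [Field F] [Fintype F]
    [AddCommGroup V] [Module F V] [FiniteDimensional F V] [Fintype ι]
    (hι : Fintype.card ι < Fintype.card F) (k : ℕ) (W : ι → Submodule F V)
    (hW : ∀ i, Module.finrank F (W i) ≤ k) :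
    ∃ f : V →ₗ[F] (Fin k → F), ∀ i, ∀ w ∈ W i, f w = 0 → w = 0 := by
  classical
  induction k generalizing W with
  | zero =>
    refine ⟨0, fun i w hw _ => ?_⟩
    have hbot : W i = ⊥ := Submodule.finrank_eq_zero.mp (Nat.le_zero.mp (hW i))
    simpa [hbot] using hw
  | succ k ih =>
    have hexists : ∀ i, ∃ w ∈ W i, W i ≠ ⊥ → w ≠ 0 := fun i => by
      by_cases h : W i = ⊥
      · exact ⟨0, zero_mem _, fun h' => absurd h h'⟩
      · obtain ⟨w, hw, hw0⟩ := Submodule.exists_mem_ne_zero_of_ne_bot h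
        exact ⟨w, hw, fun _ => hw0⟩
    choose w hwW hw0 using hexists
    obtain ⟨g, hg⟩ := Module.Dual.exists_forall_ne_zero_of_card_lt (F := F)
      ((Finset.univ.image w).erase 0)
      (((Finset.card_erase_le).trans Finset.card_image_le).trans_lt hι) (Finset.notMem_erase _ _)
    obtain ⟨f, hf⟩ := ih (fun i => W i ⊓ LinearMap.ker g) fun i => by
      by_cases h : W i = ⊥
      · have hbot : W i ⊓ LinearMap.ker g = ⊥ := by rw [h, bot_inf_eq]
        rw [hbot, finrank_bot]
        exact Nat.zero_le k
      · have hlt : W i ⊓ LinearMap.ker g < W i := by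
          refine inf_lt_left.mpr fun hle => hg (w i) ?_ (hle (hwW i))
          simp [hw0 i h]
        have := Submodule.finrank_lt_finrank_of_lt hlt
        have := hW i
        omega
    refine ⟨LinearMap.pi (Fin.cons g fun j => LinearMap.proj j ∘ₗ f), fun i v hv hfv => ?_⟩
    refine hf i v ⟨hv, ?_⟩ (funext fun j => ?_)
    · simpa using congrFun hfv 0
    · simpa using congrFun hfv j.succ

/-- Matrix form of `LinearMap.exists_disjoint_ker_of_card_lt`, with any number of rows at least the
dimension bound. -/
theorem Matrix.exists_mulVec_ne_zero_of_card_lt {F n ι : Type*} [Field F] [Fintype F]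
    [Fintype n] [DecidableEq n] [Fintype ι] (hι : Fintype.card ι < Fintype.card F) (k : ℕ)
    (W : ι → Submodule F (n → F)) (hW : ∀ i, Module.finrank F (W i) ≤ k) :
    ∃ S : Matrix (Fin k) n F, ∀ i, ∀ w ∈ W i, S.mulVec w = 0 → w = 0 := by
  obtain ⟨f, hf⟩ := LinearMap.exists_disjoint_ker_of_card_lt hι k W hW
  exact ⟨LinearMap.toMatrix' f, fun i w hw h => hf i w hw (by
    rwa [LinearMap.toMatrix'_mulVec] at h)⟩

/-- A vector of Hamming weight at most `k` is mapped by `A` into the span of `k` columns. -/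
theorem Matrix.exists_mulVec_mem_span_col {F m n : Type*} [Field F] [DecidableEq F]
    [Fintype n] (A : Matrix m n F) {k : ℕ} (d : n → F)
    (hd : hammingNorm d ≤ k) (hd0 : d ≠ 0) :
    ∃ t : Fin k → n, A.mulVec d ∈ Submodule.span F (Set.range fun j => A.col (t j)) := by
  classical
  let s : Finset n := {i | d i ≠ 0}
  have hs : Fintype.card s ≤ Fintype.card (Fin k) := by
    rw [Fintype.card_coe, Fintype.card_fin]
    exact hd
  obtain ⟨φ⟩ := Function.Embedding.nonempty_of_card_le hs
  obtain ⟨i₀, hi₀⟩ := Function.ne_iff.mp hd0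
  have : Nonempty s := ⟨⟨i₀, by simpa [s] using hi₀⟩⟩
  refine ⟨fun j => (Function.invFun φ j : s), ?_⟩
  rw [Matrix.mulVec_eq_sum]
  refine Submodule.sum_mem _ fun i _ => ?_
  by_cases hi : d i = 0
  · simp [hi]
  · have hcol : A.col i ∈ Set.range fun j => A.col (Function.invFun φ j : s) :=
      ⟨φ ⟨i, by simpa [s] using hi⟩, by simp [Function.leftInverse_invFun φ.injective _]⟩
    simpa using! Submodule.smul_mem _ (d i) (Submodule.subset_span hcol)


/-- Achievability for the function-updates problem (Lemma 1 of the paper).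
For a finite field `F` with `|F| ≥ 2εB^{2ε}`, a `θ×B` matrix `A` with `θ ≤ B`,
`0 ≤ ε ≤ B`, and `γ ≥ min(2ε, rank A)`, there exist a `γ×θ` matrix `S` and a decoder `D`
such that for all `x, e ∈ F^B` with Hamming weight of `e` at most `ε`,
`D((S·A)·(x+e), A·x) = A·(x+e)`. -/
theorem function_updates_achievability
    (F : Type*) [Field F] [Fintype F] [DecidableEq F]
    (B θ ε γ : ℕ) (hθB : θ ≤ B) (hεB : ε ≤ B)
    (hq : 2 * ε * B ^ (2 * ε) ≤ Fintype.card F)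
    (A : Matrix (Fin θ) (Fin B) F)
    (hγ : min (2 * ε) A.rank ≤ γ) :
    ∃ (S : Matrix (Fin γ) (Fin θ) F)
      (D : (Fin γ → F) × (Fin θ → F) → (Fin θ → F)),
      ∀ x e : Fin B → F, hammingNorm e ≤ ε →
        D ((S * A).mulVec (x + e), A.mulVec x) = A.mulVec (x + e) := by
  classical
  suffices h : ∃ S : Matrix (Fin γ) (Fin θ) F, ∀ d : Fin B → F, hammingNorm d ≤ 2 * ε →
      S.mulVec (A.mulVec d) = 0 → A.mulVec d = 0 by
    obtain ⟨S, hS⟩ := h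
    let P (p : (Fin γ → F) × (Fin θ → F)) (y : Fin θ → F) : Prop :=
      ∃ x e : Fin B → F, hammingNorm e ≤ ε ∧
        ((S * A).mulVec (x + e), A.mulVec x) = p ∧ A.mulVec (x + e) = y
    refine ⟨S, fun p => if h : ∃ y, P p y then h.choose else 0, fun x e he => ?_⟩
    have hP : ∃ y, P ((S * A).mulVec (x + e), A.mulVec x) y := ⟨_, x, e, he, rfl, rfl⟩
    change (if h : ∃ y, P ((S * A).mulVec (x + e), A.mulVec x) y then h.choose else 0) = _
    rw [dif_pos hP]
    obtain ⟨x', e', he', hp, hy⟩ := hP.choose_spec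
    rw [← hy]
    obtain ⟨hS', hA'⟩ := Prod.mk.inj hp
    have hweight : hammingNorm (e' - e) ≤ 2 * ε := by
      have htri := hammingDist_triangle e 0 e'
      rw [hammingDist_eq_hammingNorm, neg_add_eq_sub, hammingDist_zero_right, hammingDist_zero_left] at htri
      omega
    have hdiff : A.mulVec (e' - e) = A.mulVec (x' + e') - A.mulVec (x + e) := by
      rw [Matrix.mulVec_sub, Matrix.mulVec_add, Matrix.mulVec_add, hA']
      abel
    have hzero := hS (e' - e) hweight (by
      rw [hdiff, Matrix.mulVec_sub, Matrix.mulVec_mulVec, Matrix.mulVec_mulVec, hS', sub_self])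
    rw [hdiff] at hzero
    exact sub_eq_zero.mp hzero
  rcases min_le_iff.mp hγ with h | h
  · have hcard : Fintype.card (Fin (2 * ε) → Fin B) < Fintype.card F := by
      rcases Nat.eq_zero_or_pos ε with rfl | hε
      · simpa using Fintype.one_lt_card (α := F)
      · have hpos : 0 < B ^ (2 * ε) := pow_pos (hε.trans_le hεB) _
        simp only [Fintype.card_fun, Fintype.card_fin]
        nlinarith
    obtain ⟨S, hS⟩ := Matrix.exists_mulVec_ne_zero_of_card_lt hcard γ
      (fun t => Submodule.span F (Set.range fun j => A.col (t j)))
      fun t => (finrank_range_le_card _).trans (by simpa using h)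
    refine ⟨S, fun d hd hSd => ?_⟩
    rcases eq_or_ne d 0 with rfl | hd0
    · exact Matrix.mulVec_zero A
    · obtain ⟨t, ht⟩ := A.exists_mulVec_mem_span_col d hd hd0
      exact hS t _ ht hSd
  · obtain ⟨S, hS⟩ := Matrix.exists_mulVec_ne_zero_of_card_lt (F := F) (ι := Unit)
      (by simpa using Fintype.one_lt_card (α := F)) γ
      (fun _ => LinearMap.range A.mulVecLin) fun _ => h
    exact ⟨S, fun d _ hSd => hS () _ ⟨d, rfl⟩ hSd⟩
end

section
/- Let F be a finite field with |F| ≥ 2εB^{2ε}, let P be a θ'×B matrix over F, let C be a θ×θ' matrix over F, set A = C·P (a θ×B matrix), let 0 ≤ ε ≤ B, and let γ be a natural number with γ ≥ min(2ε, rank(A)). Then there exist a γ×θ matrix S over F and a decoder function D : F^γ × F^θ → F^θ such that for all column vectors x, e ∈ F^B with Hamming weight of e at most ε, D((S·C)·(P·(x + e)), A·x) = A·(x + e). -/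
open Module in
/-- Over a field with more than `|ι|` elements, finitely many nonzero vectors indexed by `ι`
can be simultaneously detected by one linear functional. -/
theorem exists_dual_forall_apply_ne_zero_of_card_lt {ι K V : Type*} [Fintype ι] [Field K]
    [AddCommGroup V] [Module K V] (hcard : (Fintype.card ι : ENat) < ENat.card K)
    (v : ι → V) (hv : ∀ i, v i ≠ 0) : ∃ f : Dual K V, ∀ i, f (v i) ≠ 0 := by
  have hne (i : ι) : LinearMap.ker (Dual.eval K V (v i)) ≠ ⊤ := by
    intro h
    refine hv i ((forall_dual_apply_eq_zero_iff K (v i)).mp fun f => ?_)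
    have : f ∈ LinearMap.ker (Dual.eval K V (v i)) := h ▸ Submodule.mem_top
    simpa using this
  have hcover := Submodule.iUnion_ssubset_of_forall_ne_top_of_card_lt Finset.univ _ hne
    (by simpa using hcard)
  obtain ⟨f, -, hf⟩ := Set.exists_of_ssubset hcover
  exact ⟨f, by simpa using hf⟩

/-- Over a field with more than `|ι|` elements, subspaces `W i` of dimension at most `k` admit
a common linear map to `K ^ k` that is injective on each of them. -/
theorem exists_linearMap_forall_disjoint_ker {ι K V : Type*} [Fintype ι] [Field K]
    [AddCommGroup V] [Module K V] [FiniteDimensional K V]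
    (hcard : (Fintype.card ι : ENat) < ENat.card K) (k : ℕ) (W : ι → Submodule K V)
    (hW : ∀ i, Module.finrank K (W i) ≤ k) :
    ∃ f : V →ₗ[K] (Fin k → K), ∀ i, ∀ w ∈ W i, f w = 0 → w = 0 := by
  induction k generalizing W with
  | zero =>
    refine ⟨0, fun i w hw _ => ?_⟩
    rw [Submodule.finrank_eq_zero.mp (Nat.le_zero.mp (hW i))] at hw
    exact (Submodule.mem_bot K).mp hw
  | succ k ih =>
    have hv (i : {i // W i ≠ ⊥}) : ∃ v ∈ W i, v ≠ 0 := Submodule.exists_mem_ne_zero_of_ne_bot i.2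
    choose v hvW hv0 using hv
    classical
    obtain ⟨s, hs⟩ := exists_dual_forall_apply_ne_zero_of_card_lt
      (lt_of_le_of_lt (by exact_mod_cast Fintype.card_subtype_le _) hcard) v hv0
    obtain ⟨f, hf⟩ := ih (fun i => W i ⊓ LinearMap.ker s) fun i => by
      by_cases hi : W i = ⊥
      · rw [hi, bot_inf_eq, finrank_bot]
        exact k.zero_le
      · refine Nat.lt_succ_iff.mp ((Submodule.finrank_lt_finrank_of_lt ?_).trans_le (hW i))
        refine inf_le_left.lt_of_ne fun h => hs ⟨i, hi⟩ ?_
        exact (inf_eq_left.mp h) (hvW ⟨i, hi⟩)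
    refine ⟨LinearMap.pi (Fin.cons s fun j => LinearMap.proj j ∘ₗ f), fun i w hw h => ?_⟩
    refine hf i w ⟨hw, by simpa using congrFun h 0⟩ (funext fun j => ?_)
    simpa using congrFun h j.succ

/-- A vector whose weight is at most `k` is supported on the range of a map from `Fin k`. -/
theorem exists_forall_apply_ne_zero_mem_range {F ι : Type*} [Zero F] [DecidableEq F] [Fintype ι]
    {v : ι → F} {k : ℕ} (hv0 : v ≠ 0) (hv : hammingNorm v ≤ k) :
    ∃ g : Fin k → ι, ∀ i, v i ≠ 0 → i ∈ Set.range g := by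
  obtain ⟨a, ha⟩ := Function.ne_iff.mp hv0
  have : Nonempty {i // v i ≠ 0} := ⟨⟨a, ha⟩⟩
  obtain ⟨φ⟩ : Nonempty ({i // v i ≠ 0} ↪ Fin k) :=
    Function.Embedding.nonempty_of_card_le (by
      simpa [Fintype.card_subtype, hammingNorm] using hv)
  exact ⟨fun j => (Function.invFun φ j).1, fun i hi =>
    ⟨φ ⟨i, hi⟩, congrArg Subtype.val (Function.leftInverse_invFun φ.injective _)⟩⟩

/-- If `v` is supported on the range of `g`, then `A v` lies in the span of the corresponding
columns of `A`. -/
theorem Matrix.mulVec_mem_span_col_of_support {F m n κ : Type*} [Field F] [Fintype n]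
    (A : Matrix m n F) {v : n → F} {g : κ → n} (h : ∀ i, v i ≠ 0 → i ∈ Set.range g) :
    A.mulVec v ∈ Submodule.span F (Set.range fun j => A.col (g j)) := by
  rw [Matrix.mulVec_eq_sum]
  refine Submodule.sum_mem _ fun i _ => ?_
  by_cases hi : v i = 0
  · simp [hi]
  · obtain ⟨j, rfl⟩ := h i hi
    simpa using! Submodule.smul_mem _ (v (g j)) (Submodule.subset_span (Set.mem_range_self j))

/-- A matrix `S` with `γ ≥ min (2 ε) (rank A)` rows such that `S A` annihilates no more vectors
of weight at most `2 ε` than `A` does. -/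
theorem exists_matrix_mulVec_eq_zero_of_hammingNorm_le
    {F : Type*} [Field F] [Fintype F] [DecidableEq F] {B θ ε γ : ℕ} (hεB : ε ≤ B)
    (hq : 2 * ε * B ^ (2 * ε) ≤ Fintype.card F) (A : Matrix (Fin θ) (Fin B) F)
    (hγ : min (2 * ε) A.rank ≤ γ) :
    ∃ S : Matrix (Fin γ) (Fin θ) F, ∀ v : Fin B → F, hammingNorm v ≤ 2 * ε →
      S.mulVec (A.mulVec v) = 0 → A.mulVec v = 0 := by
  have hone : 1 < Fintype.card F := Fintype.one_lt_card
  rcases min_le_iff.mp hγ with hγ | hγ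
  · have hcard : B ^ (2 * ε) < Fintype.card F := by
      rcases Nat.eq_zero_or_pos ε with rfl | hε
      · simpa using hone
      · have : 0 < B ^ (2 * ε) := pow_pos (hε.trans_le hεB) _
        nlinarith
    obtain ⟨f, hf⟩ := exists_linearMap_forall_disjoint_ker (K := F) (ι := Fin (2 * ε) → Fin B)
      (by simpa using! (Nat.cast_lt (α := ENat)).mpr hcard) γ
      (fun g => Submodule.span F (Set.range fun j => A.col (g j)))
      fun g => (finrank_range_le_card _).trans (by simpa using hγ)
    refine ⟨LinearMap.toMatrix' f, fun v hv h => ?_⟩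
    rw [LinearMap.toMatrix'_mulVec] at h
    rcases eq_or_ne v 0 with rfl | hv0
    · simp
    · obtain ⟨g, hg⟩ := exists_forall_apply_ne_zero_mem_range hv0 hv
      exact hf g _ (A.mulVec_mem_span_col_of_support hg) h
  · obtain ⟨f, hf⟩ := exists_linearMap_forall_disjoint_ker (K := F) (ι := Unit)
      (by simpa using! (Nat.cast_lt (α := ENat)).mpr hone) γ
      (fun _ => LinearMap.range A.mulVecLin) fun _ => hγ
    refine ⟨LinearMap.toMatrix' f, fun v _ h => ?_⟩
    rw [LinearMap.toMatrix'_mulVec] at h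
    exact hf () _ ⟨v, rfl⟩ h


/-- Achievability for the first variant of the function-updates problem
(Lemma 2 of the paper). The source observes `P·(x+e)` where `A = C·P`; there exist a
`γ×θ` matrix `S` and a decoder `D` such that for all `x, e ∈ F^B` with Hamming weight of `e`
at most `ε`, `D((S·C)·(P·(x+e)), A·x) = A·(x+e)`, whenever `|F| ≥ 2εB^{2ε}` and
`γ ≥ min(2ε, rank A)`. -/
theorem function_updates_variant1_achievability
    (F : Type*) [Field F] [Fintype F] [DecidableEq F]
    (B θ θ' ε γ : ℕ) (hεB : ε ≤ B)
    (hq : 2 * ε * B ^ (2 * ε) ≤ Fintype.card F)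
    (P : Matrix (Fin θ') (Fin B) F) (C : Matrix (Fin θ) (Fin θ') F)
    (A : Matrix (Fin θ) (Fin B) F) (hA : A = C * P)
    (hγ : min (2 * ε) A.rank ≤ γ) :
    ∃ (S : Matrix (Fin γ) (Fin θ) F)
      (D : (Fin γ → F) × (Fin θ → F) → (Fin θ → F)),
      ∀ x e : Fin B → F, hammingNorm e ≤ ε →
        D ((S * C).mulVec (P.mulVec (x + e)), A.mulVec x) = A.mulVec (x + e) := by
  obtain ⟨S, hS⟩ := exists_matrix_mulVec_eq_zero_of_hammingNorm_le hεB hq A hγ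
  classical
  refine ⟨S, fun yz => if h : ∃ p : (Fin B → F) × (Fin B → F), hammingNorm p.2 ≤ ε ∧
    ((S * C).mulVec (P.mulVec (p.1 + p.2)), A.mulVec p.1) = yz
    then A.mulVec (h.choose.1 + h.choose.2) else 0, fun x e he => ?_⟩
  have h : ∃ p : (Fin B → F) × (Fin B → F), hammingNorm p.2 ≤ ε ∧
      ((S * C).mulVec (P.mulVec (p.1 + p.2)), A.mulVec p.1) =
        ((S * C).mulVec (P.mulVec (x + e)), A.mulVec x) := ⟨(x, e), he, rfl⟩
  refine (dif_pos h).trans ?_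
  obtain ⟨hw, heq⟩ := h.choose_spec
  obtain ⟨h₁, h₂⟩ := Prod.ext_iff.mp heq
  generalize h.choose = p at hw h₁ h₂ ⊢
  have hSC (v : Fin B → F) : (S * C).mulVec (P.mulVec v) = S.mulVec (A.mulVec v) := by
    simp [hA, Matrix.mulVec_mulVec, Matrix.mul_assoc]
  simp only [hSC, Matrix.mulVec_add] at h₁ h₂ ⊢
  rw [h₂, add_right_inj] at h₁ ⊢
  have hweight : hammingNorm (p.2 - e) ≤ 2 * ε := by
    have := hammingDist_triangle e 0 p.2
    rw [hammingDist_zero_right, hammingDist_zero_left, hammingDist_eq_hammingNorm,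
      neg_add_eq_sub] at this
    omega
  rw [← sub_eq_zero, ← Matrix.mulVec_sub]
  exact hS _ hweight (by rw [Matrix.mulVec_sub, Matrix.mulVec_sub, h₁, sub_self])
end

section
/- Let F be a finite field with |F| ≥ 2εB^{2ε}, let α ≥ 1, and for each i ∈ {1, …, α} let C_i be a θ×θ'_i matrix and P_i a θ'_i×B matrix over F. Set A = Σ_{i=1}^{α} C_i·P_i (a θ×B matrix), let 0 ≤ ε ≤ B, and let γ be a natural number with γ ≥ min(2ε, rank(A)). Then there exist a γ×θ matrix S over F and a decoder function D : (F^γ)^α × F^θ → F^θ such that for all column vectors x, e ∈ F^B with Hamming weight of e at most ε, D( ((S·C_1)·(P_1·(x+e)), …, (S·C_α)·(P_α·(x+e))), A·x ) = A·(x + e). -/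
/-- Over a field with more than `Fintype.card ι` elements, finitely many subspaces of dimension at
most `n` have a common subspace of codimension at most `n` that is disjoint from each of them. -/
theorem Submodule.exists_disjoint_finrank_quotient_le {K V ι : Type*} [Field K] [AddCommGroup V]
    [Module K V] [FiniteDimensional K V] [Fintype ι] (U : ι → Submodule K V) (n : ℕ)
    (hU : ∀ i, Module.finrank K (U i) ≤ n) (hcard : Fintype.card ι < ENat.card K) :
    ∃ W : Submodule K V, (∀ i, Disjoint W (U i)) ∧ Module.finrank K (V ⧸ W) ≤ n := by
  obtain ⟨W, hW⟩ := exists_maximal_of_wellFoundedGT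
    (fun W : Submodule K V => ∀ i, Disjoint W (U i)) ⟨⊥, fun i => disjoint_bot_left⟩
  refine ⟨W, hW.prop, ?_⟩
  by_contra! hn
  have hproper : ∀ i, W ⊔ U i ≠ ⊤ := by
    intro i htop
    have h₁ := Submodule.finrank_add_le_finrank_add_finrank W (U i)
    have h₂ := Submodule.finrank_quotient_add_finrank W
    have h₃ := hU i
    rw [htop, finrank_top] at h₁
    omega
  obtain ⟨v, -, hv⟩ := Set.exists_of_ssubset
    (Submodule.iUnion_ssubset_of_forall_ne_top_of_card_lt Finset.univ _ hproper
      (by simpa using hcard))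
  simp only [Finset.mem_univ, Set.iUnion_true, Set.mem_iUnion, SetLike.mem_coe, not_exists] at hv
  have hsup : ∀ i, Disjoint (W ⊔ Submodule.span K {v}) (U i) := by
    intro i
    have hv0 : v ≠ 0 := fun h => hv i (h ▸ Submodule.zero_mem _)
    refine (Disjoint.disjoint_sup_right_of_disjoint_sup_left (hW.prop i).symm ?_).symm
    rw [sup_comm]
    exact (Submodule.disjoint_span_singleton' hv0).2 (hv i)
  have hvW : v ∈ W := hW.le_of_ge hsup le_sup_left
    (Submodule.mem_sup_right (Submodule.mem_span_singleton_self v))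
  by_cases hι : Nonempty ι
  · exact hv hι.some (Submodule.mem_sup_left hvW)
  · have htop : W = ⊤ := top_le_iff.1 (hW.le_of_ge (fun i => (hι ⟨i⟩).elim) le_top)
    have h₂ := Submodule.finrank_quotient_add_finrank W
    rw [htop, finrank_top] at h₂
    rw [htop] at hn
    omega

/-- Over a sufficiently large field, some `n`-row matrix acts injectively on each of finitely many
subspaces of dimension at most `n`. -/
theorem Matrix.exists_mulVec_injective_on_submodules {K ι m : Type*} [Field K] [Fintype m]
    [Fintype ι] (U : ι → Submodule K (m → K)) (n : ℕ)
    (hU : ∀ i, Module.finrank K (U i) ≤ n) (hcard : Fintype.card ι < ENat.card K) :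
    ∃ S : Matrix (Fin n) m K, ∀ i, ∀ u ∈ U i, S.mulVec u = 0 → u = 0 := by
  classical
  obtain ⟨W, hWU, hWn⟩ := Submodule.exists_disjoint_finrank_quotient_le U n hU hcard
  obtain ⟨f, hf⟩ := (finrank_le_iff_exists_linearMap (R := K) (M' := Fin n → K)).1
    (by simpa using hWn)
  refine ⟨LinearMap.toMatrix' (f ∘ₗ W.mkQ), fun i u hu h => ?_⟩
  rw [LinearMap.toMatrix'_mulVec, LinearMap.comp_apply, map_eq_zero_iff f hf,
    Submodule.mkQ_apply, Submodule.Quotient.mk_eq_zero] at h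
  exact Submodule.disjoint_def.1 (hWU i) u h hu

/-- A product `A.mulVec e` lies in the span of any family of columns covering the support
of `e`. -/
theorem Matrix.mulVec_mem_span_col {K κ m n : Type*} [Field K] [Fintype n]
    (A : Matrix m n K) (e : n → K) (f : κ → n) (hf : ∀ j, e j ≠ 0 → j ∈ Set.range f) :
    A.mulVec e ∈ Submodule.span K (Set.range (fun k => A.col (f k))) := by
  rw [Matrix.mulVec_eq_sum]
  refine Submodule.sum_mem _ fun j _ => ?_
  by_cases hj : e j = 0
  · simp [hj]
  · obtain ⟨k, rfl⟩ := hf j hj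
    rw [op_smul_eq_smul]
    exact Submodule.smul_mem _ _ (Submodule.subset_span (Set.mem_range_self k))

/-- A nonempty finset with at most `n` elements lies in the range of a map from `Fin n`. -/
theorem Finset.exists_fin_map_subset_range {β : Type*} (s : Finset β) (hs : s.Nonempty) {n : ℕ}
    (hn : s.card ≤ n) : ∃ f : Fin n → β, ∀ j ∈ s, j ∈ Set.range f := by
  obtain ⟨b, -⟩ := hs
  let g : s ↪ Fin n := s.equivFin.toEmbedding.trans (Fin.castLEEmb hn)
  refine ⟨Function.extend g Subtype.val fun _ => b, fun j hj => ⟨g ⟨j, hj⟩, ?_⟩⟩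
  exact g.injective.extend_apply _ _ _

/-- Over a sufficiently large field, `A.mulVec e` can be recovered, for sparse `e`, from
`min k A.rank` linear measurements. -/
theorem Matrix.exists_mulVec_injective_on_sparse {K m : Type*} [Field K] [Fintype K]
    [DecidableEq K] [Fintype m] (B k n : ℕ) (A : Matrix m (Fin B) K)
    (hq : B ^ k < Fintype.card K) (hn : min k A.rank ≤ n) :
    ∃ S : Matrix (Fin n) m K, ∀ e : Fin B → K, hammingNorm e ≤ k →
      S.mulVec (A.mulVec e) = 0 → A.mulVec e = 0 := by
  rcases min_le_iff.1 hn with hk | hr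
  · obtain ⟨S, hS⟩ := Matrix.exists_mulVec_injective_on_submodules
      (fun f : Fin k → Fin B => Submodule.span K (Set.range fun j => A.col (f j))) n
      (fun f => (finrank_range_le_card _).trans (by simpa using hk))
      (by
        rw [ENat.card_eq_coe_fintype_card, Nat.cast_lt]
        simpa using hq)
    refine ⟨S, fun e he h => ?_⟩
    rcases eq_or_ne e 0 with rfl | he0
    · simp
    obtain ⟨f, hf⟩ := Finset.exists_fin_map_subset_range (Finset.univ.filter fun j => e j ≠ 0)
      (Finset.card_pos.1 (hammingNorm_pos_iff.2 he0)) he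
    exact hS f _ (A.mulVec_mem_span_col e f fun j hj => hf j (by simpa using hj)) h
  · obtain ⟨S, hS⟩ := Matrix.exists_mulVec_injective_on_submodules
      (fun _ : Unit => LinearMap.range A.mulVecLin) n (fun _ => hr)
      (by simpa using Fintype.one_lt_card (α := K))
    exact ⟨S, fun e _ h => hS () _ ⟨e, rfl⟩ h⟩

theorem hammingNorm_sub_le_add {K ι : Type*} [AddGroup K] [DecidableEq K] [Fintype ι]
    (x y : ι → K) : hammingNorm (x - y) ≤ hammingNorm x + hammingNorm y := by
  classical
  refine (Finset.card_le_card ?_).trans (Finset.card_union_le _ _)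
  intro j hj
  simp only [Finset.mem_filter, Finset.mem_univ, true_and, Finset.mem_union, Pi.sub_apply] at hj ⊢
  by_contra! h
  exact hj (by rw [h.1, h.2, sub_zero])


/-- Achievability for the multi-source variant of the function-updates problem
(Lemma 3 of the paper). There are `α ≥ 1` sources; source `i` observes `P_i·(x+e)` and uses
encoder `S·C_i`, where `A = Σ_i C_i·P_i`. There exist a `γ×θ` matrix `S` and a decoder `D`
recovering `A·(x+e)` from the `α` encoded messages and side information `A·x`, whenever
`|F| ≥ 2εB^{2ε}` and `γ ≥ min(2ε, rank A)`. -/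
theorem function_updates_multisource_achievability
    (F : Type*) [Field F] [Fintype F] [DecidableEq F]
    (B θ ε γ α : ℕ) (hα : 1 ≤ α) (hεB : ε ≤ B)
    (hq : 2 * ε * B ^ (2 * ε) ≤ Fintype.card F)
    (θ' : Fin α → ℕ)
    (C : ∀ i : Fin α, Matrix (Fin θ) (Fin (θ' i)) F)
    (P : ∀ i : Fin α, Matrix (Fin (θ' i)) (Fin B) F)
    (A : Matrix (Fin θ) (Fin B) F) (hA : A = ∑ i : Fin α, C i * P i)
    (hγ : min (2 * ε) A.rank ≤ γ) :
    ∃ (S : Matrix (Fin γ) (Fin θ) F)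
      (D : (Fin α → Fin γ → F) × (Fin θ → F) → (Fin θ → F)),
      ∀ x e : Fin B → F, hammingNorm e ≤ ε →
        D (fun i => (S * C i).mulVec ((P i).mulVec (x + e)), A.mulVec x)
          = A.mulVec (x + e) := by
  obtain ⟨S, hS⟩ : ∃ S : Matrix (Fin γ) (Fin θ) F, ∀ e : Fin B → F, hammingNorm e ≤ 2 * ε →
      S.mulVec (A.mulVec e) = 0 → A.mulVec e = 0 := by
    rcases Nat.eq_zero_or_pos ε with rfl | hε
    · refine ⟨0, fun e he _ => ?_⟩
      have he0 : e = 0 := hammingNorm_eq_zero.1 (by simpa using he)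
      rw [he0, Matrix.mulVec_zero]
    · refine Matrix.exists_mulVec_injective_on_sparse B (2 * ε) γ A ?_ hγ
      have hpos : 0 < B ^ (2 * ε) := pow_pos (hε.trans_le hεB) _
      nlinarith
  let message : {p : (Fin B → F) × (Fin B → F) // hammingNorm p.2 ≤ ε} →
      (Fin α → Fin γ → F) × (Fin θ → F) := fun p =>
    (fun i => (S * C i).mulVec ((P i).mulVec (p.1.1 + p.1.2)), A.mulVec p.1.1)
  have hsum : ∀ y : Fin B → F,
      ∑ i, (S * C i).mulVec ((P i).mulVec y) = S.mulVec (A.mulVec y) := by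
    intro y
    simp only [Matrix.mulVec_mulVec, Matrix.mul_assoc]
    rw [← Matrix.sum_mulVec, ← Matrix.mul_sum, ← hA]
  have hfactor : Function.FactorsThrough
      (fun p : {p : (Fin B → F) × (Fin B → F) // hammingNorm p.2 ≤ ε} =>
        A.mulVec (p.1.1 + p.1.2)) message := by
    rintro ⟨⟨x, e⟩, he⟩ ⟨⟨x', e'⟩, he'⟩ h
    obtain ⟨h₁, h₂⟩ := Prod.mk.inj h
    dsimp only at h₁ h₂ he he' ⊢
    have h₃ := congrArg (fun g : Fin α → Fin γ → F => ∑ i, g i) h₁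
    simp only [hsum] at h₃
    simp only [Matrix.mulVec_add, h₂, add_right_inj] at h₃
    have h₄ := hS (e - e') ((hammingNorm_sub_le_add e e').trans (by omega))
      (by rw [Matrix.mulVec_sub, Matrix.mulVec_sub, h₃, sub_self])
    rw [Matrix.mulVec_sub, sub_eq_zero] at h₄
    rw [Matrix.mulVec_add, Matrix.mulVec_add, h₂, h₄]
  exact ⟨S, Function.extend message (fun p => A.mulVec (p.1.1 + p.1.2)) 0,
    fun x e he => hfactor.extend_apply 0 ⟨(x, e), he⟩⟩
end
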